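/- Let Γ be a finite simple graph with vertex set V and let P ∈ ℤ[X] be a polynomial such that |S_{F_q}(Γ)| = P(q) for every prime power q (such a P exists and is unique). Then P(1) = |V|: the value of the counting polynomial at q = 1 (the number of F₁-rational points) equals the number of vertices of Γ. -/

import Mathlib

/-- The affine chart `A_v(Γ,k)` attached to a vertex `v` of a simple graph. -/
def Achart {V : Type*} (G : SimpleGraph V) (k : Type*) [Field k] (v : V) :
    Set (Projectivization k (V → k)) :=
  {p | ∃ (x : V → k) (hx : x ≠ 0), p = Projectivization.mk k x hx ∧
    x v ≠ 0 ∧ ∀ w : V, ¬ (w = v ∨ G.Adj v w) → x w = 0}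

/-- `S_k(Γ) = ⋃_{v ∈ V} A_v(Γ,k)`. -/
def Spts {V : Type*} (G : SimpleGraph V) (k : Type*) [Field k] :
    Set (Projectivization k (V → k)) :=
  ⋃ v : V, Achart G k v

/-- Over a finite field with `q` elements there are `(q - 1) ^ #T` functions of support `T`. -/
theorem card_filter_support_eq {V K : Type*} [Fintype V] [DecidableEq V] [Field K] [Fintype K]
    [DecidableEq K] (T : Finset V) :
    (Finset.univ.filter fun x : V → K => (Finset.univ.filter fun v => x v ≠ 0) = T).card =
      (Fintype.card K - 1) ^ T.card := by
  have h : (Finset.univ.filter fun x : V → K => (Finset.univ.filter fun v => x v ≠ 0) = T) =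
      Fintype.piFinset fun v => if v ∈ T then Finset.univ.erase (0 : K) else {0} := by
    ext x
    simp only [Finset.mem_filter, Finset.mem_univ, true_and, Fintype.mem_piFinset,
      Finset.ext_iff]
    refine forall_congr' fun v => ?_
    by_cases hv : v ∈ T <;> simp [hv]
  rw [h, Fintype.card_piFinset, ← Finset.prod_subset (Finset.subset_univ T)]
  · rw [Finset.prod_congr rfl (g := fun _ => Fintype.card K - 1), Finset.prod_const]
    intro v hv
    simp [hv, Finset.card_erase_of_mem]
  · intro v _ hv
    simp [hv]

/-- A projective point lies in `S_k(Γ)` iff the support of a representative is contained in the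
closed neighbourhood of one of its own vertices. -/
theorem mk_mem_Spts {V K : Type*} [Field K] (G : SimpleGraph V) (x : V → K) (hx : x ≠ 0) :
    Projectivization.mk K x hx ∈ Spts G K ↔
      ∃ v, x v ≠ 0 ∧ ∀ w, x w ≠ 0 → w = v ∨ G.Adj v w := by
  simp only [Spts, Set.mem_iUnion, Achart, Set.mem_ofPred_eq]
  refine exists_congr fun v => ⟨?_, fun h => ⟨x, hx, rfl, h.1, fun w => ?_⟩⟩
  · rintro ⟨y, hy, hxy, hv, h⟩
    obtain ⟨a, rfl⟩ := (Projectivization.mk_eq_mk_iff K x y hx hy).1 hxy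
    refine ⟨by simpa [Units.smul_def] using hv, fun w hw => ?_⟩
    by_contra hn
    exact hw (by simp [h w hn])
  · exact not_imp_comm.1 (h.2 w)

/-- Each projective point over a field with `q` elements has `q - 1` representatives. -/
theorem ncard_setOf_mk_mem {E K : Type*} [Field K] [Fintype K] [AddCommGroup E] [Module K E]
    (S : Set (Projectivization K E)) :
    {x : E | ∃ hx : x ≠ 0, Projectivization.mk K x hx ∈ S}.ncard =
      S.ncard * (Fintype.card K - 1) := by
  classical
  let f : Projectivization K E × Kˣ → E := fun z => z.2 • z.1.rep
  have hne : ∀ z, f z ≠ 0 := fun z => (smul_ne_zero_iff_ne z.2).2 z.1.rep_nonzero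
  have hmk : ∀ z, Projectivization.mk K (f z) (hne z) = z.1 := fun z => by
    conv_rhs => rw [← z.1.mk_rep]
    exact (Projectivization.mk_eq_mk_iff K _ _ _ _).2 ⟨z.2, rfl⟩
  have hf : Function.Injective f := by
    rintro ⟨p, a⟩ ⟨r, b⟩ h
    have hp : p = r := by
      have := hmk (p, a)
      simp only [h] at this
      exact this.symm.trans (hmk (r, b))
    subst hp
    have hab : (a : K) = b := smul_left_injective K p.rep_nonzero h
    rw [Units.ext hab]
  have himage : {x : E | ∃ hx : x ≠ 0, Projectivization.mk K x hx ∈ S} =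
      f '' (S ×ˢ Set.univ) := by
    ext x
    constructor
    · rintro ⟨hx, hS⟩
      obtain ⟨a, ha⟩ := (Projectivization.mk_eq_mk_iff K x _ hx (Projectivization.rep_nonzero _)).1
        (Projectivization.mk_rep (Projectivization.mk K x hx)).symm
      exact ⟨(_, a), ⟨hS, trivial⟩, ha⟩
    · rintro ⟨z, ⟨hz, -⟩, rfl⟩
      exact ⟨hne z, by rwa [hmk]⟩
  rw [himage, Set.ncard_image_of_injective _ hf, Set.ncard_prod, Set.ncard_univ,
    Nat.card_eq_fintype_card, Fintype.card_units]

/-- The supports of the points of `S_k(Γ)`: sets of vertices contained in the closed neighbourhood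
of one of their elements. -/
def IsStarSet {V : Type*} (G : SimpleGraph V) (T : Finset V) : Prop :=
  ∃ v ∈ T, ∀ w ∈ T, w = v ∨ G.Adj v w

theorem IsStarSet.card_pos {V : Type*} {G : SimpleGraph V} {T : Finset V} (h : IsStarSet G T) :
    0 < T.card :=
  let ⟨v, hv, _⟩ := h
  Finset.card_pos.2 ⟨v, hv⟩

open Classical in
/-- `|S_{F_q}(Γ)|` is the sum of `(q - 1) ^ (#T - 1)` over the star sets `T`. -/
theorem ncard_Spts {V K : Type*} [Fintype V] [Field K] [Fintype K] (G : SimpleGraph V) :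
    (Spts G K).ncard =
      ∑ T : Finset V with IsStarSet G T, (Fintype.card K - 1) ^ (T.card - 1) := by
  have hK : 0 < Fintype.card K - 1 := Nat.sub_pos_of_lt Fintype.one_lt_card
  refine Nat.eq_of_mul_eq_mul_right hK ?_
  let supp : (V → K) → Finset V := fun x => Finset.univ.filter fun v => x v ≠ 0
  have hset : {x : V → K | ∃ hx : x ≠ 0, Projectivization.mk K x hx ∈ Spts G K} =
      ((Finset.univ.filter fun x => IsStarSet G (supp x) : Finset (V → K)) : Set (V → K)) := by
    ext x
    simp only [Set.mem_ofPred_eq, mk_mem_Spts, Finset.coe_filter, Finset.mem_univ, true_and,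
      IsStarSet, supp, Finset.mem_filter]
    refine ⟨fun h => h.2, fun h => ⟨?_, h⟩⟩
    rintro rfl
    obtain ⟨v, hv, -⟩ := h
    exact hv rfl
  rw [← ncard_setOf_mk_mem, hset, Set.ncard_coe_finset, Finset.sum_mul,
    Finset.card_eq_sum_card_fiberwise (f := supp)
      (t := Finset.univ.filter fun T => IsStarSet G T) (fun x hx => by simpa using hx)]
  refine Finset.sum_congr rfl fun T hT => ?_
  have hT' : IsStarSet G T := (Finset.mem_filter.1 hT).2
  rw [← pow_succ, Nat.sub_add_cancel hT'.card_pos, ← card_filter_support_eq T, Finset.filter_filter]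
  congr 1
  ext x
  simp only [Finset.mem_filter, Finset.mem_univ, true_and]
  exact ⟨fun h => h.2, fun h => ⟨by rwa [show supp x = T from h], h⟩⟩

open Classical in
/-- Only the singletons contribute to the counting polynomial at `q = 1`. -/
theorem sum_zero_pow_isStarSet {V : Type*} [Fintype V] (G : SimpleGraph V) :
    ∑ T : Finset V with IsStarSet G T, (0 : ℤ) ^ (T.card - 1) = Fintype.card V := by
  have h : ∀ T ∈ Finset.univ.filter (fun T : Finset V => IsStarSet G T),
      (0 : ℤ) ^ (T.card - 1) = if T.card = 1 then 1 else 0 := fun T hT => by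
    have hT' := (Finset.mem_filter.1 hT).2.card_pos
    rw [zero_pow_eq]
    exact if_congr (by omega) rfl rfl
  have hsingle : (Finset.univ.filter fun T : Finset V => IsStarSet G T ∧ T.card = 1) =
      Finset.univ.powersetCard 1 := by
    ext T
    simp only [Finset.mem_filter, Finset.mem_univ, true_and, Finset.mem_powersetCard,
      Finset.subset_univ, and_iff_right_iff_imp]
    intro hT
    obtain ⟨v, rfl⟩ := Finset.card_eq_one.1 hT
    exact ⟨v, by simp, by simp⟩
  rw [Finset.sum_congr rfl h, Finset.sum_boole, Finset.filter_filter, hsingle,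
    Finset.card_powersetCard, Finset.card_univ, Nat.choose_one_right]

/-- if `P ∈ ℤ[X]` is a counting polynomial for `Γ`, i.e.
`|S_{F_q}(Γ)| = P(q)` for every finite field `F_q`, then `P(1) = |V|`: the number of
`F₁`-rational points equals the number of vertices. -/
theorem stmt5 {V : Type*} [Fintype V] [DecidableEq V] (G : SimpleGraph V)
    (P : Polynomial ℤ)
    (hP : ∀ (K : Type) [Field K] [Fintype K] (q : ℕ),
      Fintype.card K = q → ((Spts G K).ncard : ℤ) = P.eval (q : ℤ)) :
    P.eval 1 = Fintype.card V := by
  classical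
  let Q : Polynomial ℤ :=
    ∑ T : Finset V with IsStarSet G T, (Polynomial.X - 1) ^ (T.card - 1)
  have hQ : ∀ z : ℤ, Q.eval z =
      ∑ T : Finset V with IsStarSet G T, (z - 1) ^ (T.card - 1) := fun z => by
    simp [Q, Polynomial.eval_finsetSum]
  have hPQ : P = Q := by
    refine Polynomial.eq_of_infinite_eval_eq P Q
      ((Nat.infinite_setOfPred_prime.image (f := ((↑) : ℕ → ℤ))
        Nat.cast_injective.injOn).mono ?_)
    rintro _ ⟨p, hp, rfl⟩
    have : Fact p.Prime := ⟨hp⟩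
    have hp1 : 1 ≤ p := Nat.Prime.one_le hp
    rw [Set.mem_ofPred_eq, hQ, ← hP (ZMod p) p (ZMod.card p), ncard_Spts, ZMod.card]
    push_cast [hp1]
    rfl
  rw [hPQ, hQ, sub_self, sum_zero_pow_isStarSet]
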